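/- arXiv:math/0301007 — 3 statements merged into one kernel-verified Lean document; each statement's English description precedes it below -/
import Mathlib

section
/- Let S be a real symmetric positive definite m×m matrix and let g ≥ 1. Then for every τ in the Siegel upper half space ℍ_g, the theta series θ_S^{(g)}(τ) = ∑_{G ∈ Mat(m,g;ℤ)} exp[πi·Tr(ᵗG·S·G·τ)] converges absolutely (i.e. the family of terms indexed by integer m×g matrices G is summable). -/
open scoped Matrix BigOperators
open Matrix

noncomputable section

/-- A complex `g × g` matrix lies in the Siegel upper half space `ℍ_g` iff it is
symmetric and its imaginary part is positive definite. -/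
def IsSiegel {g : ℕ} (τ : Matrix (Fin g) (Fin g) ℂ) : Prop :=
  τ.IsSymm ∧ (Matrix.of fun i j => (τ i j).im).PosDef

/-- The term indexed by an integer `m × g` matrix `G` of the genus `g` theta series of
an `m × m` real quadratic form `S`:  `exp[πi · Tr(ᵗG·S·G·τ)]`. -/
def quadThetaTerm (m g : ℕ) (S : Matrix (Fin m) (Fin m) ℝ)
    (τ : Matrix (Fin g) (Fin g) ℂ) (G : Matrix (Fin m) (Fin g) ℤ) : ℂ :=
  Complex.exp ((Real.pi : ℂ) * Complex.I *
    Matrix.trace ((G.map (Int.cast : ℤ → ℂ))ᵀ * S.map (Complex.ofReal) *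
      G.map (Int.cast : ℤ → ℂ) * τ))

open scoped Kronecker

/-- A positive definite real matrix is bounded below by a positive multiple of the identity. -/
theorem Matrix.PosDef.exists_pos_mul_dotProduct_self_le {ι : Type*} [Fintype ι]
    {A : Matrix ι ι ℝ} (hA : A.PosDef) :
    ∃ c > 0, ∀ x : ι → ℝ, c * (x ⬝ᵥ x) ≤ x ⬝ᵥ A *ᵥ x := by
  classical
  open scoped MatrixOrder in
  cases isEmpty_or_nonempty ι with
  | inl h => exact ⟨1, one_pos, fun x => by simp [dotProduct]⟩
  | inr h =>
    obtain ⟨c, hc, hcA⟩ := (CFC.exists_pos_algebraMap_le_iff (a := A) hA.isHermitian).2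
      fun x hx => hA.isStrictlyPositive.spectrum_pos hx
    refine ⟨c, hc, fun x => ?_⟩
    have h := (Matrix.le_iff.1 hcA).dotProduct_mulVec_nonneg x
    rw [Algebra.algebraMap_eq_smul_one, sub_mulVec, smul_mulVec, one_mulVec, dotProduct_sub,
      dotProduct_smul, star_trivial, smul_eq_mul] at h
    linarith

/-- The product over a finite index set of copies of a nonnegative summable function is
summable. -/
theorem Summable.prod_comp_eval_of_nonneg {ι κ : Type*} [Fintype ι] {f : κ → ℝ}
    (hf : Summable f) (hf0 : 0 ≤ f) : Summable fun n : ι → κ => ∏ i, f (n i) := by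
  classical
  refine summable_of_sum_le (c := ∏ _i : ι, ∑' k, f k)
    (fun n => Finset.prod_nonneg fun i _ => hf0 (n i)) fun u => ?_
  calc ∑ n ∈ u, ∏ i, f (n i)
      ≤ ∑ n ∈ Fintype.piFinset fun i => u.image fun n => n i, ∏ i, f (n i) :=
        Finset.sum_le_sum_of_subset_of_nonneg
          (fun n hn => Fintype.mem_piFinset.2 fun i => Finset.mem_image_of_mem (fun n => n i) hn)
          fun n _ _ => Finset.prod_nonneg fun i _ => hf0 (n i)
    _ = ∏ i, ∑ k ∈ u.image fun n => n i, f k := (Finset.prod_univ_sum _ fun _ => f).symm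
    _ ≤ ∏ _i : ι, ∑' k, f k :=
        Finset.prod_le_prod (fun i _ => Finset.sum_nonneg fun k _ => hf0 k)
          fun i _ => hf.sum_le_tsum _ fun k _ => hf0 k

/-- The Gaussian attached to a positive definite real matrix is summable over integer vectors. -/
theorem Matrix.PosDef.summable_exp_neg_pi_mul {ι : Type*} [Fintype ι]
    {A : Matrix ι ι ℝ} (hA : A.PosDef) :
    Summable fun n : ι → ℤ =>
      Real.exp (-Real.pi * ((fun i => (n i : ℝ)) ⬝ᵥ A *ᵥ fun i => (n i : ℝ))) := by
  obtain ⟨c, hc, hcA⟩ := hA.exists_pos_mul_dotProduct_self_le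
  have h1 : Summable fun k : ℤ => Real.exp (-Real.pi * (c * k ^ 2)) := by
    simpa using summable_pow_mul_jacobiTheta₂_term_bound 0 hc 0
  refine (h1.prod_comp_eval_of_nonneg (ι := ι) fun k => (Real.exp_pos _).le).of_nonneg_of_le
    (fun n => (Real.exp_pos _).le) fun n => ?_
  rw [← Real.exp_sum, Real.exp_le_exp, ← Finset.mul_sum, ← Finset.mul_sum]
  have h2 := hcA fun i => (n i : ℝ)
  simp only [dotProduct, ← sq] at h2 ⊢
  exact mul_le_mul_of_nonpos_left h2 (neg_nonpos.2 Real.pi_pos.le)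

theorem Matrix.im_trace_map_ofReal_mul {n : Type*} [Fintype n]
    (R : Matrix n n ℝ) (τ : Matrix n n ℂ) :
    (trace (R.map Complex.ofReal * τ)).im = trace (R * Matrix.of fun i j => (τ i j).im) := by
  simp [trace, mul_apply]

theorem norm_quadThetaTerm (m g : ℕ) (S : Matrix (Fin m) (Fin m) ℝ)
    (τ : Matrix (Fin g) (Fin g) ℂ) (G : Matrix (Fin m) (Fin g) ℤ) :
    ‖quadThetaTerm m g S τ G‖ = Real.exp (-Real.pi *
      (vec (G.map (Int.cast : ℤ → ℝ)) ⬝ᵥ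
        ((Matrix.of fun i j => (τ i j).im)ᵀ ⊗ₖ S) *ᵥ vec (G.map (Int.cast : ℤ → ℝ)))) := by
  have hG : (G.map (Int.cast : ℤ → ℂ))ᵀ * S.map Complex.ofReal * G.map (Int.cast : ℤ → ℂ) =
      ((G.map (Int.cast : ℤ → ℝ))ᵀ * S * G.map (Int.cast : ℤ → ℝ)).map Complex.ofReal := by
    ext i j
    simp [mul_apply]
  rw [quadThetaTerm, hG, Complex.norm_exp, kronecker_mulVec_vec, vec_dotProduct_vec,
    transpose_transpose, ← Matrix.mul_assoc, ← Matrix.mul_assoc, ← im_trace_map_ofReal_mul]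
  simp [Complex.mul_re]

/-- Let `S` be a real symmetric positive definite `m × m` matrix and `g ≥ 1`.  Then for
every `τ` in the Siegel upper half space `ℍ_g` the theta series
`θ_S^{(g)}(τ) = ∑_{G ∈ Mat(m,g;ℤ)} exp[πi·Tr(ᵗG·S·G·τ)]` converges absolutely, i.e. the
family of its terms indexed by integer `m × g` matrices `G` is summable. -/
theorem quadThetaSeries_summable (m g : ℕ) (hg : 1 ≤ g)
    (S : Matrix (Fin m) (Fin m) ℝ) (hSsymm : S.IsSymm) (hSpos : S.PosDef)
    (τ : Matrix (Fin g) (Fin g) ℂ) (hτ : IsSiegel τ) :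
    Summable (quadThetaTerm m g S τ) := by
  have hA := hτ.2.transpose.kronecker hSpos
  refine Summable.of_norm ?_
  simp_rw [norm_quadThetaTerm]
  have hinj : Function.Injective (vec : Matrix (Fin m) (Fin g) ℤ → _) :=
    fun _ _ => vec_inj.1
  exact hA.summable_exp_neg_pi_mul.comp_injective hinj
end
end

section
/- For every τ in the Siegel upper half space ℍ_3, the following relation among genus 3 theta constants holds: θ[0,0,0;0,0,0](τ)·θ[0,0,0;1,0,0](τ)·θ[0,0,0;0,1,0](τ)·θ[0,0,0;1,1,0](τ) − θ[0,0,1;0,0,0](τ)·θ[0,0,1;1,0,0](τ)·θ[0,0,1;0,1,0](τ)·θ[0,0,1;1,1,0](τ) − θ[0,0,0;0,0,1](τ)·θ[0,0,0;1,0,1](τ)·θ[0,0,0;0,1,1](τ)·θ[0,0,0;1,1,1](τ) = 0. -/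
open scoped Matrix BigOperators
open Matrix

noncomputable section

/-- The theta constant `θ[ε;ε'](τ) = ∑_{m∈ℤ^g} exp[πi(ᵗ(m+ε/2)·τ·(m+ε/2) + ᵗ(m+ε/2)·ε')]`. -/
def thetaConst (g : ℕ) (ε ε' : Fin g → Fin 2) (τ : Matrix (Fin g) (Fin g) ℂ) : ℂ :=
  ∑' m : Fin g → ℤ, Complex.exp ((Real.pi : ℂ) * Complex.I *
    ((∑ i, ∑ j, ((m i : ℂ) + ((ε i : ℕ) : ℂ) / 2) * τ i j * ((m j : ℂ) + ((ε j : ℕ) : ℂ) / 2)) +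
      ∑ i, ((m i : ℂ) + ((ε i : ℕ) : ℂ) / 2) * ((ε' i : ℕ) : ℂ)))

/-- `r₁(τ) = θ[0,0,0;0,0,0]·θ[0,0,0;1,0,0]·θ[0,0,0;0,1,0]·θ[0,0,0;1,1,0]`. -/
def r₁ (τ : Matrix (Fin 3) (Fin 3) ℂ) : ℂ :=
  thetaConst 3 ![0,0,0] ![0,0,0] τ * thetaConst 3 ![0,0,0] ![1,0,0] τ *
    thetaConst 3 ![0,0,0] ![0,1,0] τ * thetaConst 3 ![0,0,0] ![1,1,0] τ

/-- `r₂(τ) = θ[0,0,1;0,0,0]·θ[0,0,1;1,0,0]·θ[0,0,1;0,1,0]·θ[0,0,1;1,1,0]`. -/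
def r₂ (τ : Matrix (Fin 3) (Fin 3) ℂ) : ℂ :=
  thetaConst 3 ![0,0,1] ![0,0,0] τ * thetaConst 3 ![0,0,1] ![1,0,0] τ *
    thetaConst 3 ![0,0,1] ![0,1,0] τ * thetaConst 3 ![0,0,1] ![1,1,0] τ

/-- `r₃(τ) = θ[0,0,0;0,0,1]·θ[0,0,0;1,0,1]·θ[0,0,0;0,1,1]·θ[0,0,0;1,1,1]`. -/
def r₃ (τ : Matrix (Fin 3) (Fin 3) ℂ) : ℂ :=
  thetaConst 3 ![0,0,0] ![0,0,1] τ * thetaConst 3 ![0,0,0] ![1,0,1] τ *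
    thetaConst 3 ![0,0,0] ![0,1,1] τ * thetaConst 3 ![0,0,0] ![1,1,1] τ

/-- The term `exp(πi/4 · ᵗu τ u)` of a theta series, indexed by the doubled lattice vector `u`. -/
def thetaTerm {g : ℕ} (τ : Matrix (Fin g) (Fin g) ℂ) (u : Fin g → ℤ) : ℂ :=
  Complex.exp ((Real.pi : ℂ) * Complex.I / 4 * ∑ i, ∑ j, (u i : ℂ) * τ i j * (u j : ℂ))

lemma Matrix.PosDef.exists_mul_sum_sq_le {n : ℕ} {Y : Matrix (Fin n) (Fin n) ℝ} (hY : Y.PosDef) :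
    ∃ c > 0, ∀ x : Fin n → ℝ, c * ∑ i, x i ^ 2 ≤ ∑ i, ∑ j, x i * Y i j * x j := by
  have key : ∀ x : Fin n → ℝ,
      star x ⬝ᵥ (Y *ᵥ x) = ∑ i, ∑ j, x i * Y i j * x j := fun x => by
    simp [dotProduct, mulVec, Finset.mul_sum, mul_assoc]
  let q : EuclideanSpace ℝ (Fin n) → ℝ := fun x => ∑ i, ∑ j, x i * Y i j * x j
  have hpos : ∀ x, x ≠ 0 → 0 < q x := fun x hx => by
    have := hY.dotProduct_mulVec_pos (x := fun i => x i) (by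
      contrapose! hx
      ext i
      exact congrFun hx i)
    rwa [key] at this
  have hcont : Continuous q := by fun_prop
  obtain ⟨c, hc, hle⟩ : ∃ c > 0, ∀ x ∈ Metric.sphere (0 : EuclideanSpace ℝ (Fin n)) 1, c ≤ q x := by
    rcases (Metric.sphere (0 : EuclideanSpace ℝ (Fin n)) 1).eq_empty_or_nonempty with h | h
    · exact ⟨1, one_pos, by simp [h]⟩
    · obtain ⟨x₀, hx₀, hmin⟩ := (isCompact_sphere _ _).exists_isMinOn h hcont.continuousOn
      exact ⟨q x₀, hpos _ (Metric.ne_of_mem_sphere hx₀ one_ne_zero), hmin⟩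
  refine ⟨c, hc, fun x => ?_⟩
  let v : EuclideanSpace ℝ (Fin n) := WithLp.toLp 2 x
  have hv : ‖v‖ ^ 2 = ∑ i, x i ^ 2 := by simp [EuclideanSpace.norm_sq_eq, v]
  rw [← hv]
  rcases eq_or_ne v 0 with h0 | h0
  · have hx : x = 0 := by simpa [v] using h0
    simp [h0, hx]
  · have hn : ‖v‖ ≠ 0 := norm_ne_zero_iff.mpr h0
    have h1 := hle (‖v‖⁻¹ • v) (by simp [norm_smul, hn])
    have h2 : q (‖v‖⁻¹ • v) = (‖v‖ ^ 2)⁻¹ * ∑ i, ∑ j, x i * Y i j * x j := by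
      simp only [q, v, PiLp.smul_apply, smul_eq_mul, Finset.mul_sum]
      refine Finset.sum_congr rfl fun i _ => Finset.sum_congr rfl fun j _ => ?_
      field_simp
    rw [h2] at h1
    have h3 : 0 < ‖v‖ ^ 2 := by positivity
    calc c * ‖v‖ ^ 2
        ≤ ((‖v‖ ^ 2)⁻¹ * ∑ i, ∑ j, x i * Y i j * x j) * ‖v‖ ^ 2 := by gcongr
      _ = _ := by field_simp

lemma summable_pi_prod_of_nonneg {α : Type*} {f : α → ℝ} (hf : Summable f) (h0 : ∀ a, 0 ≤ f a)
    (n : ℕ) : Summable fun u : Fin n → α => ∏ i, f (u i) := by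
  induction n with
  | zero => exact Summable.of_finite
  | succ n ih =>
    rw [← (Fin.consEquiv fun _ : Fin (n + 1) => α).summable_iff]
    refine (hf.mul_of_nonneg ih h0 fun u => Finset.prod_nonneg fun i _ => h0 _).congr fun p => ?_
    simp [Fin.consEquiv, Fin.prod_univ_succ]

lemma summable_exp_neg_mul_sq {c : ℝ} (hc : 0 < c) :
    Summable fun n : ℤ => Real.exp (-(c * (n : ℝ) ^ 2)) := by
  refine (summable_pow_mul_jacobiTheta₂_term_bound 0 (div_pos hc Real.pi_pos) 0).congr fun n => ?_
  simp only [pow_zero, one_mul]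
  congr 1
  field_simp
  simp

lemma IsSiegel.summable_norm_thetaTerm {g : ℕ} {τ : Matrix (Fin g) (Fin g) ℂ} (hτ : IsSiegel τ) :
    Summable fun u : Fin g → ℤ => ‖thetaTerm τ u‖ := by
  obtain ⟨c, hc, hle⟩ := hτ.2.exists_mul_sum_sq_le
  refine (summable_pi_prod_of_nonneg (summable_exp_neg_mul_sq
    (show 0 < Real.pi / 4 * c by positivity)) (fun _ => (Real.exp_pos _).le) g).of_nonneg_of_le
    (fun _ => norm_nonneg _) fun u => ?_
  rw [thetaTerm, Complex.norm_exp, ← Real.exp_sum, Real.exp_le_exp]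
  have h : ((Real.pi : ℂ) * Complex.I / 4 * ∑ i, ∑ j, (u i : ℂ) * τ i j * (u j : ℂ)).re
      = -(Real.pi / 4 * ∑ i, ∑ j, (u i : ℝ) * (τ i j).im * (u j : ℝ)) := by
    have : (Real.pi : ℂ) * Complex.I / 4 = ((Real.pi / 4 : ℝ) : ℂ) * Complex.I := by
      push_cast; ring
    rw [this, mul_assoc, Complex.re_ofReal_mul, Complex.I_mul_re, Complex.im_sum]
    simp [Complex.im_sum, Complex.mul_im]
  rw [h, Finset.sum_neg_distrib, neg_le_neg_iff, ← Finset.mul_sum, mul_assoc]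
  have := hle fun i => (u i : ℝ)
  simp only [Matrix.of_apply] at this
  simp only [mul_assoc, ← Finset.mul_sum] at this ⊢
  gcongr

/-- For characteristics `(ε, ε')` of a single coordinate with `ε = 0` or `ε' = 0`: the factor by
which the doubled coordinate `z ≡ 2 * m + ε` contributes to the terms of the theta constant. -/
def charWeight (ε ε' : Fin 2) (z : ZMod 4) : ℤ :=
  if z.val % 2 = ε then (if ε' = 1 ∧ z = 2 then -1 else 1) else 0

lemma exp_pi_I_mul_int (m : ℤ) : Complex.exp (Real.pi * Complex.I * m) = (-1) ^ m := by
  rw [mul_comm, Complex.exp_int_mul, Complex.exp_pi_mul_I]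

lemma charWeight_two_mul_add {ε ε' : Fin 2} (h : ε = 0 ∨ ε' = 0) (m : ℤ) :
    (charWeight ε ε' ((2 * m + (ε : ℕ) : ℤ) : ZMod 4) : ℂ) =
      Complex.exp (Real.pi * Complex.I * ((m + ((ε : ℕ) : ℂ) / 2) * ((ε' : ℕ) : ℂ))) := by
  have hc : ∀ k : ℤ, ((4 * k : ℤ) : ZMod 4) = 0 := fun k =>
    (ZMod.intCast_zmod_eq_zero_iff_dvd _ 4).2 ⟨k, rfl⟩
  obtain ⟨k, rfl | rfl⟩ := Int.even_or_odd' m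
  · have hz : ((2 * (2 * k) + (ε : ℕ) : ℤ) : ZMod 4) = (ε : ℕ) := by
      have := hc k
      push_cast at this ⊢
      linear_combination this
    rw [hz]
    fin_cases ε <;> fin_cases ε' <;> simp at h ⊢
    · decide
    · have := exp_pi_I_mul_int (2 * k)
      push_cast at this
      rw [this, _root_.zpow_mul]
      have : charWeight 0 1 0 = 1 := by decide
      simp [this]
    · decide
  · have hz : ((2 * (2 * k + 1) + (ε : ℕ) : ℤ) : ZMod 4) = 2 + (ε : ℕ) := by
      have := hc k
      push_cast at this ⊢
      linear_combination this
    rw [hz]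
    fin_cases ε <;> fin_cases ε' <;> simp at h ⊢
    · decide
    · have := exp_pi_I_mul_int (2 * k + 1)
      push_cast at this
      rw [this, zpow_add₀ (by norm_num), _root_.zpow_mul]
      have : charWeight 0 1 2 = -1 := by decide
      simp [this]
    · decide

lemma thetaConst_eq_tsum {g : ℕ} {ε ε' : Fin g → Fin 2} (h : ∀ i, ε i = 0 ∨ ε' i = 0)
    (τ : Matrix (Fin g) (Fin g) ℂ) :
    thetaConst g ε ε' τ =
      ∑' u : Fin g → ℤ, (∏ i, (charWeight (ε i) (ε' i) (u i) : ℂ)) * thetaTerm τ u := by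
  let f : (Fin g → ℤ) → Fin g → ℤ := fun m i => 2 * m i + ((ε i : ℕ) : ℤ)
  have hf : Function.Injective f := fun m m' hm => by
    funext i
    have := congrFun hm i
    simp only [f] at this
    omega
  rw [thetaConst, ← hf.tsum_eq
    (f := fun u => (∏ i, (charWeight (ε i) (ε' i) (u i) : ℂ)) * thetaTerm τ u)]
  · refine tsum_congr fun m => ?_
    simp only [f, charWeight_two_mul_add (h _), thetaTerm]
    rw [← Complex.exp_sum, ← Complex.exp_add]
    congr 1
    rw [mul_add, add_comm]
    simp only [Finset.mul_sum]
    congr 1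
    refine Finset.sum_congr rfl fun i _ => Finset.sum_congr rfl fun j _ => ?_
    push_cast
    ring
  · intro u hu
    have hprod := left_ne_zero_of_mul (Function.mem_support.1 hu)
    refine ⟨fun i => u i / 2, ?_⟩
    funext i
    have hi := Finset.prod_ne_zero_iff.1 hprod i (Finset.mem_univ i)
    have hv : (u i : ZMod 4).val % 2 = ε i := by
      by_contra hne
      simp [charWeight, hne] at hi
    have h4 := ZMod.val_intCast (n := 4) (u i)
    simp only [f]
    push_cast at h4
    omega

/-- A weight attached to one coordinate of a quadruple of doubled lattice vectors. -/
abbrev RowWeight := ZMod 4 → ZMod 4 → ZMod 4 → ZMod 4 → ℤ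

/-- The value of a triple of row weights at a quadruple of vectors. -/
def quadWeight (w₀ w₁ w₂ : RowWeight) (a b c d : Fin 3 → ZMod 4) : ℤ :=
  w₀ (a 0) (b 0) (c 0) (d 0) * w₁ (a 1) (b 1) (c 1) (d 1) * w₂ (a 2) (b 2) (c 2) (d 2)

/-- The term of `quadSum` at a quadruple of lattice vectors. -/
def quadTerm (τ : Matrix (Fin 3) (Fin 3) ℂ) (w₀ w₁ w₂ : RowWeight)
    (p : (Fin 3 → ℤ) × (Fin 3 → ℤ) × (Fin 3 → ℤ) × (Fin 3 → ℤ)) : ℂ :=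
  quadWeight w₀ w₁ w₂ (fun i => p.1 i) (fun i => p.2.1 i) (fun i => p.2.2.1 i)
    (fun i => p.2.2.2 i) *
  (thetaTerm τ p.1 * (thetaTerm τ p.2.1 * (thetaTerm τ p.2.2.1 * thetaTerm τ p.2.2.2)))

/-- The fourfold theta series whose terms are weighted by a triple of row weights. -/
def quadSum (τ : Matrix (Fin 3) (Fin 3) ℂ) (w₀ w₁ w₂ : RowWeight) : ℂ :=
  ∑' p, quadTerm τ w₀ w₁ w₂ p

lemma IsSiegel.summable_quadTerm {τ : Matrix (Fin 3) (Fin 3) ℂ} (hτ : IsSiegel τ)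
    (w₀ w₁ w₂ : RowWeight) : Summable (quadTerm τ w₀ w₁ w₂) := by
  have h := hτ.summable_norm_thetaTerm
  have h4 := h.mul_norm (h.mul_norm (h.mul_norm h))
  obtain ⟨C, hC⟩ := Finite.exists_le
    fun q : (Fin 3 → ZMod 4) × (Fin 3 → ZMod 4) × (Fin 3 → ZMod 4) × (Fin 3 → ZMod 4) =>
      ‖(quadWeight w₀ w₁ w₂ q.1 q.2.1 q.2.2.1 q.2.2.2 : ℂ)‖
  refine (h4.mul_left C).of_norm_bounded fun p => ?_
  rw [quadTerm, norm_mul]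
  gcongr
  exact hC (_, _, _, _)

/-- The row weight of a product of four theta constants in one coordinate. -/
def prodWeight (ε ε₁ ε₂ ε₃ ε₄ : Fin 2) : RowWeight := fun a b c d =>
  charWeight ε ε₁ a * charWeight ε ε₂ b * charWeight ε ε₃ c * charWeight ε ε₄ d

lemma IsSiegel.thetaConst_mul_eq_quadSum {τ : Matrix (Fin 3) (Fin 3) ℂ} (hτ : IsSiegel τ)
    {ε ε₁ ε₂ ε₃ ε₄ : Fin 3 → Fin 2} (h₁ : ∀ i, ε i = 0 ∨ ε₁ i = 0) (h₂ : ∀ i, ε i = 0 ∨ ε₂ i = 0)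
    (h₃ : ∀ i, ε i = 0 ∨ ε₃ i = 0) (h₄ : ∀ i, ε i = 0 ∨ ε₄ i = 0) :
    thetaConst 3 ε ε₁ τ * thetaConst 3 ε ε₂ τ * thetaConst 3 ε ε₃ τ * thetaConst 3 ε ε₄ τ =
      quadSum τ (prodWeight (ε 0) (ε₁ 0) (ε₂ 0) (ε₃ 0) (ε₄ 0))
        (prodWeight (ε 1) (ε₁ 1) (ε₂ 1) (ε₃ 1) (ε₄ 1))
        (prodWeight (ε 2) (ε₁ 2) (ε₂ 2) (ε₃ 2) (ε₄ 2)) := by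
  have hs : ∀ ε' : Fin 3 → Fin 2, Summable fun u : Fin 3 → ℤ =>
      ‖(∏ i, (charWeight (ε i) (ε' i) (u i) : ℂ)) * thetaTerm τ u‖ := fun ε' => by
    obtain ⟨C, hC⟩ := Finite.exists_le
      fun u : Fin 3 → ZMod 4 => ‖∏ i, (charWeight (ε i) (ε' i) (u i) : ℂ)‖
    refine (hτ.summable_norm_thetaTerm.mul_left C).of_nonneg_of_le (fun _ => norm_nonneg _)
      fun u => ?_
    rw [norm_mul]
    gcongr
    exact hC fun i => u i
  rw [thetaConst_eq_tsum h₁, thetaConst_eq_tsum h₂, thetaConst_eq_tsum h₃, thetaConst_eq_tsum h₄,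
    mul_assoc, mul_assoc, tsum_mul_tsum_of_summable_norm (hs _) (hs _),
    tsum_mul_tsum_of_summable_norm (hs _) ((hs _).mul_norm (hs _)),
    tsum_mul_tsum_of_summable_norm (hs _) ((hs _).mul_norm ((hs _).mul_norm (hs _)))]
  refine tsum_congr fun p => ?_
  simp only [quadTerm, quadWeight, prodWeight, Fin.prod_univ_three]
  push_cast
  ring

lemma IsSiegel.quadSum_add_left {τ : Matrix (Fin 3) (Fin 3) ℂ} (hτ : IsSiegel τ)
    (v w w₁ w₂ : RowWeight) :
    quadSum τ (v + w) w₁ w₂ = quadSum τ v w₁ w₂ + quadSum τ w w₁ w₂ := by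
  rw [quadSum, quadSum, quadSum,
    ← (hτ.summable_quadTerm _ _ _).tsum_add (hτ.summable_quadTerm _ _ _)]
  refine tsum_congr fun p => ?_
  simp only [quadTerm, quadWeight, Pi.add_apply]
  push_cast
  ring

lemma IsSiegel.quadSum_add_middle {τ : Matrix (Fin 3) (Fin 3) ℂ} (hτ : IsSiegel τ)
    (w₀ v w w₂ : RowWeight) :
    quadSum τ w₀ (v + w) w₂ = quadSum τ w₀ v w₂ + quadSum τ w₀ w w₂ := by
  rw [quadSum, quadSum, quadSum,
    ← (hτ.summable_quadTerm _ _ _).tsum_add (hτ.summable_quadTerm _ _ _)]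
  refine tsum_congr fun p => ?_
  simp only [quadTerm, quadWeight, Pi.add_apply]
  push_cast
  ring

lemma IsSiegel.quadSum_add_right {τ : Matrix (Fin 3) (Fin 3) ℂ} (hτ : IsSiegel τ)
    (w₀ w₁ v w : RowWeight) :
    quadSum τ w₀ w₁ (v + w) = quadSum τ w₀ w₁ v + quadSum τ w₀ w₁ w := by
  rw [quadSum, quadSum, quadSum,
    ← (hτ.summable_quadTerm _ _ _).tsum_add (hτ.summable_quadTerm _ _ _)]
  refine tsum_congr fun p => ?_
  simp only [quadTerm, quadWeight, Pi.add_apply]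
  push_cast
  ring

lemma quadSum_swap_adjacent (τ : Matrix (Fin 3) (Fin 3) ℂ) (w₀ w₁ w₂ : RowWeight) :
    quadSum τ (fun a b c d => w₀ b a d c) (fun a b c d => w₁ b a d c)
      (fun a b c d => w₂ b a d c) = quadSum τ w₀ w₁ w₂ := by
  have hinv : Function.Involutive
      fun p : (Fin 3 → ℤ) × (Fin 3 → ℤ) × (Fin 3 → ℤ) × (Fin 3 → ℤ) =>
        (p.2.1, p.1, p.2.2.2, p.2.2.1) := fun _ => rfl
  rw [quadSum, quadSum, ← hinv.toPerm.tsum_eq (quadTerm τ w₀ w₁ w₂)]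
  refine tsum_congr fun p => ?_
  simp only [quadTerm, quadWeight, Function.Involutive.coe_toPerm]
  ring

lemma quadSum_swap_halves (τ : Matrix (Fin 3) (Fin 3) ℂ) (w₀ w₁ w₂ : RowWeight) :
    quadSum τ (fun a b c d => w₀ c d a b) (fun a b c d => w₁ c d a b)
      (fun a b c d => w₂ c d a b) = quadSum τ w₀ w₁ w₂ := by
  have hinv : Function.Involutive
      fun p : (Fin 3 → ℤ) × (Fin 3 → ℤ) × (Fin 3 → ℤ) × (Fin 3 → ℤ) =>
        (p.2.2.1, p.2.2.2, p.1, p.2.1) := fun _ => rfl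
  rw [quadSum, quadSum, ← hinv.toPerm.tsum_eq (quadTerm τ w₀ w₁ w₂)]
  refine tsum_congr fun p => ?_
  simp only [quadTerm, quadWeight, Function.Involutive.coe_toPerm]
  ring

lemma quadSum_neg_first (τ : Matrix (Fin 3) (Fin 3) ℂ) (w₀ w₁ w₂ : RowWeight) :
    quadSum τ (fun a => w₀ (-a)) (fun a => w₁ (-a)) (fun a => w₂ (-a)) = quadSum τ w₀ w₁ w₂ := by
  have hinv : Function.Involutive
      fun p : (Fin 3 → ℤ) × (Fin 3 → ℤ) × (Fin 3 → ℤ) × (Fin 3 → ℤ) => (-p.1, p.2) :=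
    fun _ => by simp
  rw [quadSum, quadSum, ← hinv.toPerm.tsum_eq (quadTerm τ w₀ w₁ w₂)]
  refine tsum_congr fun p => ?_
  simp [quadTerm, quadWeight, thetaTerm]

/-- The reflection of a quadruple of lattice vectors in the hyperplane orthogonal to
`(1, 1, 1, 1)`, where it is integral, extended by the identity. -/
def quadReflect (p : (Fin 3 → ℤ) × (Fin 3 → ℤ) × (Fin 3 → ℤ) × (Fin 3 → ℤ)) :
    (Fin 3 → ℤ) × (Fin 3 → ℤ) × (Fin 3 → ℤ) × (Fin 3 → ℤ) :=
  let s := p.1 + p.2.1 + p.2.2.1 + p.2.2.2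
  let h : Fin 3 → ℤ := fun i => s i / 2
  if ∀ i, s i % 2 = 0 then (p.1 - h, p.2.1 - h, p.2.2.1 - h, p.2.2.2 - h) else p

lemma quadReflect_of_add_eq {a b c d h : Fin 3 → ℤ} (hs : ∀ i, a i + b i + c i + d i = 2 * h i) :
    quadReflect (a, b, c, d) = (a - h, b - h, c - h, d - h) := by
  have hh : (fun i => (a + b + c + d) i / 2) = h := by
    funext i
    simp only [Pi.add_apply, hs]
    omega
  simp only [quadReflect, hh]
  rw [if_pos]
  intro i
  simp [hs]

lemma quadReflect_involutive : Function.Involutive quadReflect := by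
  rintro ⟨a, b, c, d⟩
  by_cases hs : ∀ i, (a i + b i + c i + d i) % 2 = 0
  · have hh : ∀ i, a i + b i + c i + d i = 2 * ((a i + b i + c i + d i) / 2) := fun i => by
      have := hs i
      omega
    rw [quadReflect_of_add_eq hh,
      quadReflect_of_add_eq (h := fun i => -((a i + b i + c i + d i) / 2))]
    · ext i <;> simp
    · intro i
      have := hh i
      simp only [Pi.sub_apply]
      linarith
  · have : quadReflect (a, b, c, d) = (a, b, c, d) := if_neg hs
    rw [this, this]

lemma thetaTerm_sub_mul_eq {g : ℕ} (τ : Matrix (Fin g) (Fin g) ℂ) {a b c d h : Fin g → ℤ}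
    (hs : ∀ i, a i + b i + c i + d i = 2 * h i) :
    thetaTerm τ (a - h) * (thetaTerm τ (b - h) * (thetaTerm τ (c - h) * thetaTerm τ (d - h))) =
      thetaTerm τ a * (thetaTerm τ b * (thetaTerm τ c * thetaTerm τ d)) := by
  simp only [thetaTerm, ← Complex.exp_add, ← mul_add, ← Finset.sum_add_distrib]
  congr 2
  refine Finset.sum_congr rfl fun i _ => Finset.sum_congr rfl fun j _ => ?_
  have hd : ∀ i, d i = 2 * h i - a i - b i - c i := fun i => by linarith [hs i]
  simp only [Pi.sub_apply, hd]
  push_cast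
  ring

/-- The row weights `v` and `w` vanish on quadruples of odd sum, and are exchanged by the reflection
in the hyperplane orthogonal to `(1, 1, 1, 1)` on the others. -/
def ReflectsTo (v w : RowWeight) : Prop :=
  ∀ a b c d : ZMod 4, (2 * (a + b + c + d) ≠ 0 → v a b c d = 0 ∧ w a b c d = 0) ∧
    ∀ t, a + b + c + d = 2 * t → w (a - t) (b - t) (c - t) (d - t) = v a b c d

instance (v w : RowWeight) : Decidable (ReflectsTo v w) := by
  unfold ReflectsTo
  infer_instance

lemma quadSum_reflect (τ : Matrix (Fin 3) (Fin 3) ℂ) {v₀ v₁ v₂ w₀ w₁ w₂ : RowWeight}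
    (h₀ : ReflectsTo v₀ w₀) (h₁ : ReflectsTo v₁ w₁) (h₂ : ReflectsTo v₂ w₂) :
    quadSum τ v₀ v₁ v₂ = quadSum τ w₀ w₁ w₂ := by
  rw [quadSum, quadSum, ← quadReflect_involutive.toPerm.tsum_eq (quadTerm τ w₀ w₁ w₂)]
  refine tsum_congr ?_
  rintro ⟨a, b, c, d⟩
  rw [Function.Involutive.coe_toPerm]
  by_cases hs : ∀ i, (a i + b i + c i + d i) % 2 = 0
  · obtain ⟨h, hh⟩ : ∃ h : Fin 3 → ℤ, ∀ i, a i + b i + c i + d i = 2 * h i :=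
      ⟨fun i => (a i + b i + c i + d i) / 2, fun i => by
        have := hs i
        dsimp only
        omega⟩
    rw [quadReflect_of_add_eq hh]
    simp only [quadTerm, quadWeight, thetaTerm_sub_mul_eq τ hh, Pi.sub_apply]
    have hz : ∀ i, (a i + b i + c i + d i : ZMod 4) = 2 * h i := fun i => by
      exact_mod_cast congrArg (Int.cast : ℤ → ZMod 4) (hh i)
    push_cast
    rw [(h₀ _ _ _ _).2 _ (hz 0), (h₁ _ _ _ _).2 _ (hz 1), (h₂ _ _ _ _).2 _ (hz 2)]
  · have : quadReflect (a, b, c, d) = (a, b, c, d) := if_neg hs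
    rw [this]
    push Not at hs
    obtain ⟨i, hi⟩ := hs
    have hz : 2 * (a i + b i + c i + d i : ZMod 4) ≠ 0 := fun h0 => hi <| by
      have h4 : ((2 * (a i + b i + c i + d i) : ℤ) : ZMod 4) = 0 := by push_cast; exact h0
      have := (ZMod.intCast_zmod_eq_zero_iff_dvd _ 4).1 h4
      push_cast at this
      omega
    simp only [quadTerm, quadWeight]
    match i, hz with
    | 0, hz =>
      rw [((h₀ _ _ _ _).1 hz).1, ((h₀ _ _ _ _).1 hz).2]
      simp
    | 1, hz =>
      rw [((h₁ _ _ _ _).1 hz).1, ((h₁ _ _ _ _).1 hz).2]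
      simp
    | 2, hz =>
      rw [((h₂ _ _ _ _).1 hz).1, ((h₂ _ _ _ _).1 hz).2]
      simp

/-- The row weight `w` restricted to quadruples of sum `2`. -/
def restrictTwo (w : RowWeight) : RowWeight := fun a b c d =>
  if a + b + c + d = 2 then w a b c d else 0

/-- The row weight `w` restricted to quadruples of sum different from `2`. -/
def restrictNeTwo (w : RowWeight) : RowWeight := fun a b c d =>
  if a + b + c + d = 2 then 0 else w a b c d

/-- Twice the part of `prodWeight 0 0 1 0 1` on quadruples of sum `0`. -/
def adjacentSymm : RowWeight := prodWeight 0 0 1 0 1 + prodWeight 0 1 0 1 0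

/-- Twice the part of `prodWeight 0 0 0 1 1` on quadruples of sum `0`. -/
def halvesSymm : RowWeight := prodWeight 0 0 0 1 1 + prodWeight 0 1 1 0 0

lemma IsSiegel.quadSum_adjacentSymm {τ : Matrix (Fin 3) (Fin 3) ℂ} (hτ : IsSiegel τ)
    (ε ε' : Fin 2) :
    quadSum τ adjacentSymm halvesSymm (prodWeight ε ε' ε' ε' ε') =
      4 * quadSum τ (prodWeight 0 0 1 0 1) (prodWeight 0 0 0 1 1) (prodWeight ε ε' ε' ε' ε') := by
  have hA := quadSum_swap_adjacent τ (prodWeight 0 0 1 0 1) (prodWeight 0 0 0 1 1)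
    (prodWeight ε ε' ε' ε' ε')
  have hB := quadSum_swap_halves τ adjacentSymm (prodWeight 0 0 0 1 1) (prodWeight ε ε' ε' ε' ε')
  have e₁ : ∀ ε ε₁ ε₂ ε₃ ε₄, (fun a b c d => prodWeight ε ε₁ ε₂ ε₃ ε₄ b a d c) =
      prodWeight ε ε₂ ε₁ ε₄ ε₃ := fun _ _ _ _ _ => by
    funext a b c d
    simp only [prodWeight]
    ring
  have e₂ : ∀ ε ε₁ ε₂ ε₃ ε₄, (fun a b c d => prodWeight ε ε₁ ε₂ ε₃ ε₄ c d a b) =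
      prodWeight ε ε₃ ε₄ ε₁ ε₂ := fun _ _ _ _ _ => by
    funext a b c d
    simp only [prodWeight]
    ring
  have e₃ : (fun a b c d => adjacentSymm c d a b) = adjacentSymm :=
    congrArg₂ (· + ·) (e₂ 0 0 1 0 1) (e₂ 0 1 0 1 0)
  rw [e₁, e₁, e₁] at hA
  rw [e₂, e₂, e₃] at hB
  rw [halvesSymm, hτ.quadSum_add_middle, hB, adjacentSymm, hτ.quadSum_add_left, hA]
  ring

lemma charWeight_neg (ε ε' : Fin 2) (z : ZMod 4) : charWeight ε ε' (-z) = charWeight ε ε' z := by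
  revert ε ε' z
  decide

lemma prodWeight_neg_first (ε ε₁ ε₂ ε₃ ε₄ : Fin 2) :
    (fun a => prodWeight ε ε₁ ε₂ ε₃ ε₄ (-a)) = prodWeight ε ε₁ ε₂ ε₃ ε₄ := by
  funext a b c d
  simp only [prodWeight, charWeight_neg]

lemma quadSum_restrictNeTwo (τ : Matrix (Fin 3) (Fin 3) ℂ) :
    quadSum τ adjacentSymm halvesSymm (restrictNeTwo (prodWeight 1 0 0 0 0)) =
      quadSum τ adjacentSymm halvesSymm (restrictTwo (prodWeight 1 0 0 0 0)) := by
  rw [← quadSum_neg_first]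
  congr 1
  · exact congrArg₂ (· + ·) (prodWeight_neg_first ..) (prodWeight_neg_first ..)
  · exact congrArg₂ (· + ·) (prodWeight_neg_first ..) (prodWeight_neg_first ..)
  · funext a b c d
    revert a b c d
    decide

lemma reflectsTo_adjacentSymm : ReflectsTo adjacentSymm adjacentSymm := by decide

lemma reflectsTo_halvesSymm : ReflectsTo halvesSymm halvesSymm := by decide

lemma reflectsTo_restrictTwo :
    ReflectsTo (restrictTwo (prodWeight 0 0 0 0 0)) (restrictTwo (prodWeight 1 0 0 0 0)) := by
  decide

lemma prodWeight_zero_eq_add : prodWeight 0 0 0 0 0 = prodWeight 0 1 1 1 1 +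
    (restrictTwo (prodWeight 0 0 0 0 0) + restrictTwo (prodWeight 0 0 0 0 0)) := by
  funext a b c d
  revert a b c d
  decide

lemma restrictTwo_add_restrictNeTwo (w : RowWeight) : restrictTwo w + restrictNeTwo w = w := by
  funext a b c d
  simp only [restrictTwo, restrictNeTwo, Pi.add_apply]
  split_ifs <;> simp

/-- The genus 3 theta relation of van Geemen–van der Geer:
`r₁(τ) − r₂(τ) − r₃(τ) = 0` for every `τ ∈ ℍ_3`. -/
theorem genus_three_theta_relation (τ : Matrix (Fin 3) (Fin 3) ℂ) (hτ : IsSiegel τ) :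
    r₁ τ - r₂ τ - r₃ τ = 0 := by
  have h₁ : r₁ τ = quadSum τ (prodWeight 0 0 1 0 1) (prodWeight 0 0 0 1 1)
      (prodWeight 0 0 0 0 0) :=
    hτ.thetaConst_mul_eq_quadSum (by decide) (by decide) (by decide) (by decide)
  have h₂ : r₂ τ = quadSum τ (prodWeight 0 0 1 0 1) (prodWeight 0 0 0 1 1)
      (prodWeight 1 0 0 0 0) :=
    hτ.thetaConst_mul_eq_quadSum (by decide) (by decide) (by decide) (by decide)
  have h₃ : r₃ τ = quadSum τ (prodWeight 0 0 1 0 1) (prodWeight 0 0 0 1 1)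
      (prodWeight 0 1 1 1 1) :=
    hτ.thetaConst_mul_eq_quadSum (by decide) (by decide) (by decide) (by decide)
  have s₁ := hτ.quadSum_adjacentSymm 0 0
  have s₂ := hτ.quadSum_adjacentSymm 1 0
  have s₃ := hτ.quadSum_adjacentSymm 0 1
  rw [← h₁, prodWeight_zero_eq_add, hτ.quadSum_add_right, hτ.quadSum_add_right,
    quadSum_reflect τ reflectsTo_adjacentSymm reflectsTo_halvesSymm reflectsTo_restrictTwo] at s₁
  rw [← h₂, ← restrictTwo_add_restrictNeTwo (prodWeight 1 0 0 0 0), hτ.quadSum_add_right,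
    quadSum_restrictNeTwo] at s₂
  rw [← h₃] at s₃
  linear_combination (s₂ + s₃ - s₁) / 4
end
end

section
/- Up to integral equivalence there is only one even, positive definite, integer quadratic form of determinant 1 and rank 8: if S₁ and S₂ are symmetric 8×8 integer matrices which are positive definite, have determinant 1, and satisfy ᵗx·S·x ≡ 0 (mod 2) for all x ∈ ℤ^8, then there exists U ∈ GL(8,ℤ) with ᵗU·S₁·U = S₂. -/
open scoped Matrix
open Matrix

open MeasureTheory in
/-- The Minkowski convex body theorem for a cylinder over a Euclidean ball of radius 2. -/
theorem exists_int_vec_mem_cylinder {k m : ℕ} (N : Matrix (Fin k ⊕ Fin m) (Fin k ⊕ Fin m) ℝ)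
    (hN : N.det ≠ 0)
    (hvol : ENNReal.ofReal (2 ^ m * |N.det|) <
      volume (Metric.ball (0 : EuclideanSpace ℝ (Fin m)) 2)) :
    ∃ x : Fin k ⊕ Fin m → ℤ, x ≠ 0 ∧
      (∀ i, |(N *ᵥ fun a => (x a : ℝ)) (Sum.inl i)| < 1) ∧
      ∑ j, (N *ᵥ fun a => (x a : ℝ)) (Sum.inr j) ^ 2 < 4 := by
  let C : Set (Fin k → ℝ) := Set.univ.pi fun _ => Set.Ioo (-1) 1
  let D : Set (Fin m → ℝ) := WithLp.toLp 2 ⁻¹' Metric.ball (0 : EuclideanSpace ℝ (Fin m)) 2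
  let K : Set (Fin k ⊕ Fin m → ℝ) :=
    MeasurableEquiv.sumPiEquivProdPi (fun _ => ℝ) ⁻¹' (C ×ˢ D)
  have hK : volume K = 2 ^ k * volume (Metric.ball (0 : EuclideanSpace ℝ (Fin m)) 2) := by
    rw [(volume_measurePreserving_sumPiEquivProdPi fun _ => ℝ).measure_preimage_equiv,
      Measure.volume_eq_prod, Measure.prod_prod, Real.volume_pi_Ioo,
      (PiLp.volume_preserving_toLp (Fin m)).measure_preimage
        measurableSet_ball.nullMeasurableSet]
    congr 1
    norm_num
  have hsymm : ∀ x ∈ K, -x ∈ K := by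
    rintro x ⟨hx, hx'⟩
    refine ⟨fun i _ => ?_, ?_⟩
    · have := hx i trivial
      exact ⟨neg_lt_neg this.2, neg_lt.1 this.1⟩
    · have hneg : (MeasurableEquiv.sumPiEquivProdPi (fun _ => ℝ) (-x)).2 =
        -(MeasurableEquiv.sumPiEquivProdPi (fun _ => ℝ) x).2 := rfl
      rw [hneg]
      simpa [D] using hx'
  have hconv : Convex ℝ K := by
    have hC : Convex ℝ C := convex_pi fun _ _ => convex_Ioo _ _
    have hD : Convex ℝ D :=
      (convex_ball (0 : EuclideanSpace ℝ (Fin m)) 2).linear_preimage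
        (WithLp.linearEquiv 2 ℝ (Fin m → ℝ)).symm.toLinearMap
    exact (hC.prod hD).linear_preimage
      (LinearEquiv.sumArrowLequivProdArrow (Fin k) (Fin m) ℝ ℝ).toLinearMap
  let b := Pi.basisFun ℝ (Fin k ⊕ Fin m)
  let s := Matrix.toLin' N ⁻¹' K
  have hs : volume (ZSpan.fundamentalDomain b) * 2 ^ Module.finrank ℝ (Fin k ⊕ Fin m → ℝ) <
      volume s := by
    rw [Measure.addHaar_preimage_linearMap _ (by simpa using hN), hK,
      ZSpan.fundamentalDomain_pi_basisFun, Real.volume_pi_Ico]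
    have hpos : 0 < |N.det| := abs_pos.2 hN
    have h2 : ENNReal.ofReal |N.det|⁻¹ * ENNReal.ofReal (2 ^ k) *
        ENNReal.ofReal (2 ^ m * |N.det|) = 2 ^ (k + m) := by
      rw [← ENNReal.ofReal_mul (by positivity), ← ENNReal.ofReal_mul (by positivity),
        show |N.det|⁻¹ * 2 ^ k * (2 ^ m * |N.det|) = 2 ^ (k + m) by field_simp; ring,
        ENNReal.ofReal_pow zero_le_two]
      simp
    have h3 := (ENNReal.mul_lt_mul_iff_right
      (a := ENNReal.ofReal |N.det|⁻¹ * ENNReal.ofReal (2 ^ k))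
      (by simp; positivity) (by finiteness)).2 hvol
    rw [h2] at h3
    simpa [ENNReal.ofReal_pow, mul_assoc, abs_inv] using h3
  have : Countable (Submodule.span ℤ (Set.range b)).toAddSubgroup :=
    inferInstanceAs (Countable (Submodule.span ℤ (Set.range b)))
  obtain ⟨x, hx0, hx⟩ := exists_ne_zero_mem_lattice_of_measure_mul_two_pow_lt_measure
    (L := (Submodule.span ℤ (Set.range b)).toAddSubgroup)
    (ZSpan.isAddFundamentalDomain b volume) (s := s)
    (fun x hx => by
      have := hsymm _ hx
      rwa [← map_neg] at this) (hconv.linear_preimage _) hs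
  have := (b.mem_span_iff_repr_mem ℤ x).1 x.2
  choose y hy using this
  have hxy : (fun a => (y a : ℝ)) = x := by
    ext a; simpa [b] using hy a
  refine ⟨y, ?_, ?_, ?_⟩
  · rintro rfl
    apply hx0
    ext a
    simp [← hxy]
  · intro i
    have := hx.1 i trivial
    rw [hxy]
    exact abs_lt.2 this
  · have := hx.2
    rw [hxy]
    simp only [D, Set.mem_preimage, mem_ball_zero_iff, EuclideanSpace.norm_eq] at this
    rw [Real.sqrt_lt' two_pos] at this
    norm_num at this
    exact this

/-- Gram matrices of even, positive definite, unimodular lattices of rank 8. -/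
structure IsEvenUnimodularPos (S : Matrix (Fin 8) (Fin 8) ℤ) : Prop where
  symm : S.IsSymm
  pos : ∀ x : Fin 8 → ℤ, x ≠ 0 → 0 < x ⬝ᵥ S *ᵥ x
  det : S.det = 1
  even : ∀ x : Fin 8 → ℤ, 2 ∣ x ⬝ᵥ S *ᵥ x

theorem dotProduct_mulVec_nonneg_real_of_int {n : Type*} [Fintype n] (S : Matrix n n ℤ)
    (h : ∀ x : n → ℤ, 0 ≤ x ⬝ᵥ S *ᵥ x) (x : n → ℝ) :
    0 ≤ x ⬝ᵥ S.map (Int.cast : ℤ → ℝ) *ᵥ x := by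
  have hd : DenseRange fun (q : n → ℚ) (i : n) => (q i : ℝ) :=
    DenseRange.piMap fun _ => Rat.denseRange_cast
  refine hd.induction_on x (isClosed_le continuous_const (by fun_prop)) fun q => ?_
  obtain ⟨b, hb⟩ := IsLocalization.exist_integer_multiples_of_finite (nonZeroDivisors ℤ) q
  choose y hy using hb
  have hb0 : ((b : ℤ) : ℝ) ≠ 0 := by exact_mod_cast nonZeroDivisors.coe_ne_zero b
  have hy' : (fun i => (y i : ℝ)) = ((b : ℤ) : ℝ) • fun i => (q i : ℝ) := by
    ext i
    have : ((y i : ℤ) : ℚ) = (b : ℤ) • q i := hy i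
    simp only [zsmul_eq_mul] at this
    simp only [Pi.smul_apply, smul_eq_mul]
    exact_mod_cast congrArg (Rat.cast : ℚ → ℝ) this
  have h1 : (((y ⬝ᵥ S *ᵥ y : ℤ)) : ℝ) =
      (fun i => (y i : ℝ)) ⬝ᵥ S.map (Int.cast : ℤ → ℝ) *ᵥ fun i => (y i : ℝ) := by
    simp [dotProduct, mulVec]
  rw [hy', mulVec_smul, dotProduct_smul, smul_dotProduct, smul_eq_mul, smul_eq_mul,
    ← mul_assoc] at h1
  have h2 : (0 : ℝ) ≤ ((y ⬝ᵥ S *ᵥ y : ℤ) : ℝ) := by exact_mod_cast h y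
  rw [h1] at h2
  exact nonneg_of_mul_nonneg_right h2 (mul_self_pos.2 hb0)

open scoped MatrixOrder Matrix.Norms.L2Operator in
theorem exists_transpose_mul_self_eq_of_int {n : Type*} [Fintype n] [DecidableEq n]
    (S : Matrix n n ℤ) (hS : S.IsSymm) (h : ∀ x : n → ℤ, 0 ≤ x ⬝ᵥ S *ᵥ x) :
    ∃ A : Matrix n n ℝ, Aᵀ * A = S.map (Int.cast : ℤ → ℝ) := by
  have hpsd : (S.map (Int.cast : ℤ → ℝ)).PosSemidef :=
    .of_dotProduct_mulVec_nonneg (by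
      ext i j
      simpa using congrArg (Int.cast : ℤ → ℝ) (hS.apply i j)) fun x => by
        simpa using dotProduct_mulVec_nonneg_real_of_int S h x
  obtain ⟨A, hA⟩ := CStarAlgebra.nonneg_iff_eq_star_mul_self.mp hpsd.nonneg
  exact ⟨A, by rw [hA]; rfl⟩

theorem exists_orthogonal_matrix_extension {n : Type*} [Fintype n] [DecidableEq n] {k m : ℕ}
    (hn : Fintype.card n = k + m) (u : Fin k → n → ℝ)
    (hu : ∀ i j, u i ⬝ᵥ u j = if i = j then 1 else 0) :
    ∃ O : Matrix (Fin k ⊕ Fin m) n ℝ, Oᵀ * O = 1 ∧ ∀ i, O (Sum.inl i) = u i := by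
  let v : Fin k ⊕ Fin m → EuclideanSpace ℝ n :=
    Sum.elim (fun i => WithLp.toLp 2 (u i)) 0
  have hv : Orthonormal ℝ ((Set.range Sum.inl).domRestrict v) := by
    rw [orthonormal_iff_ite]
    rintro ⟨_, i, rfl⟩ ⟨_, j, rfl⟩
    simp only [v, Set.domRestrict_apply, Sum.elim_inl, EuclideanSpace.inner_eq_star_dotProduct,
      star_trivial, hu, Subtype.ext_iff, Sum.inl.injEq]
    simp only [eq_comm]
  obtain ⟨b, hb⟩ := hv.exists_orthonormalBasis_extension_of_card_eq (by simp [hn])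
  let O : Matrix (Fin k ⊕ Fin m) n ℝ := Matrix.of fun i => b i
  have hO : O * Oᵀ = 1 := by
    ext i j
    have := orthonormal_iff_ite.1 b.orthonormal i j
    rw [EuclideanSpace.inner_eq_star_dotProduct] at this
    simpa [O, mul_apply, dotProduct, one_apply, mul_comm] using this
  refine ⟨O, (Matrix.mul_eq_one_comm_of_card_eq _ _ _ (by simp [hn])).1 hO, fun i => ?_⟩
  change (b (Sum.inl i)).ofLp = u i
  rw [hb (Sum.inl i) ⟨i, rfl⟩]
  rfl

open MeasureTheory in
/-- The Minkowski theorem gives a root orthogonal to the columns of `V`, provided the columns of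
`V * Q` are pairwise orthogonal roots. -/
theorem exists_short_vec_orthogonal {k m : ℕ} (hkm : k + m = 8) {S : Matrix (Fin 8) (Fin 8) ℤ}
    (hS : IsEvenUnimodularPos S) (V : Matrix (Fin 8) (Fin k) ℤ) (Q : Matrix (Fin k) (Fin k) ℤ)
    (hV : (V * Q)ᵀ * S * (V * Q) = 2) (c : ℝ) (hc : 0 < c) (hQ : 2 ^ k < c ^ 2 * (Q.det : ℝ) ^ 2)
    (hball : ENNReal.ofReal (2 ^ m * c) ≤
      volume (Metric.ball (0 : EuclideanSpace ℝ (Fin m)) 2)) :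
    ∃ x : Fin 8 → ℤ, x ⬝ᵥ S *ᵥ x = 2 ∧ (Vᵀ * S) *ᵥ x = 0 := by
  obtain ⟨A, hA⟩ := exists_transpose_mul_self_eq_of_int S hS.symm fun x => by
    by_cases hx : x = 0
    · simp [hx]
    · exact (hS.pos x hx).le
  have hmap : ∀ {a b c : ℕ} (X : Matrix (Fin a) (Fin b) ℤ) (Y : Matrix (Fin b) (Fin c) ℤ),
      (X * Y).map (Int.cast : ℤ → ℝ) = X.map (Int.cast : ℤ → ℝ) * Y.map (Int.cast : ℤ → ℝ) :=
    fun X Y => Matrix.map_mul (f := Int.castRingHom ℝ)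
  let Vr : Matrix (Fin 8) (Fin k) ℝ := V.map Int.cast
  let Sr : Matrix (Fin 8) (Fin 8) ℝ := S.map Int.cast
  let Qr : Matrix (Fin k) (Fin k) ℝ := Q.map Int.cast
  have hQr : Qr.det = Q.det := (Int.cast_det Q).symm
  let E : Matrix (Fin 8) (Fin k) ℝ := (V * Q).map Int.cast
  have hE : Eᵀ * Aᵀ * (A * E) = 2 := by
    rw [Matrix.mul_assoc, ← Matrix.mul_assoc Aᵀ, hA, ← Matrix.mul_assoc]
    have := congrArg (fun M : Matrix (Fin k) (Fin k) ℤ => M.map (Int.cast : ℤ → ℝ)) hV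
    rw [hmap, hmap] at this
    refine this.trans ?_
    ext i j
    simp [Matrix.ofNat_apply]
  obtain ⟨O, hO, hOu⟩ := exists_orthogonal_matrix_extension (n := Fin 8) (k := k) (m := m)
    (by simp [hkm]) (fun i => (√2)⁻¹ • (A * E)ᵀ i) fun i j => by
      have := congrFun (congrFun hE i) j
      rw [← Matrix.transpose_mul, Matrix.mul_apply] at this
      simp only [smul_dotProduct, dotProduct_smul, smul_eq_mul, ← mul_assoc, ← mul_inv]
      simp only [dotProduct, transpose_apply] at this ⊢
      rw [this, Real.mul_self_sqrt zero_le_two, ofNat_apply]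
      split_ifs <;> norm_num
  set M := O * A with hM
  have hMM : Mᵀ * M = S.map (Int.cast : ℤ → ℝ) := by
    rw [hM, transpose_mul, Matrix.mul_assoc, ← Matrix.mul_assoc Oᵀ, hO, Matrix.one_mul, hA]
  let N : Matrix (Fin k ⊕ Fin m) (Fin 8) ℝ :=
    fromRows ((Vᵀ * S).map Int.cast) M.toRows₂
  let P : Matrix (Fin k ⊕ Fin m) (Fin k ⊕ Fin m) ℝ :=
    fromBlocks ((√2)⁻¹ • Qrᵀ) 0 0 1
  have hPN : P * N = M := by
    have h1 : M.toRows₁ = (√2)⁻¹ • (Eᵀ * Sr) := by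
      have h : Eᵀ * Sr = (A * E)ᵀ * A := by
        rw [transpose_mul, Matrix.mul_assoc, hA]
      rw [h]
      ext i j
      rw [toRows₁_apply, hM, mul_apply_eq_vecMul, hOu, smul_vecMul]
      rfl
    have h2 : Eᵀ = Qrᵀ * Vrᵀ := by
      rw [← transpose_mul, ← hmap]
    have h3 : (Vᵀ * S).map (Int.cast : ℤ → ℝ) = Vrᵀ * Sr := hmap _ _
    rw [fromBlocks_mul_fromRows, Matrix.zero_mul, Matrix.zero_mul, add_zero, zero_add,
      Matrix.one_mul]
    nth_rewrite 2 [← fromRows_toRows M]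
    rw [h1, h2, h3, smul_mul, Matrix.mul_assoc]
  let e : Fin k ⊕ Fin m ≃ Fin 8 := finSumFinEquiv.trans (finCongr hkm)
  let N' := N.submatrix id e
  have hdet : N'.det ^ 2 * (Q.det : ℝ) ^ 2 = 2 ^ k := by
    have h1 : (P * N').det ^ 2 = 1 := by
      have : P * N' = M.submatrix id e := by rw [← hPN]; rfl
      rw [this, sq]
      nth_rewrite 1 [← det_transpose]
      rw [← det_mul, transpose_submatrix, ← submatrix_mul _ _ _ _ _ Function.bijective_id, hMM,
        det_submatrix_equiv_self, ← Int.cast_det, hS.det, Int.cast_one]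
    rw [det_mul, det_fromBlocks_zero₂₁, det_smul, det_transpose, det_one, hQr,
      Fintype.card_fin] at h1
    have h2 : ((√2)⁻¹ ^ k) ^ 2 = (2 ^ k)⁻¹ := by
      rw [← pow_mul, mul_comm, pow_mul, inv_pow, Real.sq_sqrt zero_le_two, inv_pow]
    have h3 : (2 ^ k : ℝ) ≠ 0 := by positivity
    rw [mul_pow, mul_pow, mul_pow, h2] at h1
    field_simp at h1
    linarith
  have hN0 : N'.det ≠ 0 := by
    intro h
    rw [h] at hdet
    have : (0 : ℝ) < 2 ^ k := by positivity
    simp at hdet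
    grind
  have hNc : |N'.det| < c := by
    rw [← hdet] at hQ
    exact abs_lt_of_sq_lt_sq (lt_of_mul_lt_mul_right hQ (sq_nonneg _)) hc.le
  obtain ⟨y, hy0, hy1, hy2⟩ := exists_int_vec_mem_cylinder N' hN0 (lt_of_lt_of_le
    ((ENNReal.ofReal_lt_ofReal_iff (by positivity)).2 (by gcongr)) hball)
  let x : Fin 8 → ℤ := y ∘ e.symm
  have hNx : N' *ᵥ (fun a => (y a : ℝ)) = N *ᵥ (fun a => (x a : ℝ)) := by
    rw [submatrix_mulVec_equiv]
    rfl
  rw [hNx] at hy1 hy2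
  have hVx : (Vᵀ * S) *ᵥ x = 0 := by
    ext i
    have h1 := hy1 i
    have h2 : (N *ᵥ (fun a => (x a : ℝ))) (Sum.inl i) = (((Vᵀ * S) *ᵥ x) i : ℤ) := by
      simp [N, mulVec, dotProduct]
    rw [h2] at h1
    exact Int.abs_lt_one_iff.1 (by exact_mod_cast h1)
  refine ⟨x, ?_, hVx⟩
  have hx0 : x ≠ 0 := by
    intro h
    apply hy0
    ext a
    simpa [x] using congrFun h (e a)
  have hlt : x ⬝ᵥ S *ᵥ x < 4 := by
    have h1 : ((x ⬝ᵥ S *ᵥ x : ℤ) : ℝ) = ∑ a, (M *ᵥ (fun a => (x a : ℝ))) a ^ 2 := by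
      have : ((x ⬝ᵥ S *ᵥ x : ℤ) : ℝ) =
          (fun a => (x a : ℝ)) ⬝ᵥ S.map (Int.cast : ℤ → ℝ) *ᵥ fun a => (x a : ℝ) := by
        simp [dotProduct, mulVec]
      rw [this, ← hMM, ← mulVec_mulVec, dotProduct_mulVec, vecMul_transpose]
      simp [dotProduct, sq]
    have h0 : N *ᵥ (fun a => (x a : ℝ)) =
        Sum.elim (0 : Fin k → ℝ) (M.toRows₂ *ᵥ fun a => (x a : ℝ)) := by
      rw [fromRows_mulVec]
      congr 1
      ext i
      have := congrArg (Int.cast : ℤ → ℝ) (congrFun hVx i)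
      simpa [mulVec, dotProduct] using this
    have h2 : M *ᵥ (fun a => (x a : ℝ)) = N *ᵥ (fun a => (x a : ℝ)) := by
      rw [← hPN, ← mulVec_mulVec, h0]
      simp [P, fromBlocks_mulVec]
    have h3 : ((x ⬝ᵥ S *ᵥ x : ℤ) : ℝ) < 4 := by
      rw [h1, Fintype.sum_sum_type, h2]
      simpa [h0] using hy2
    exact_mod_cast h3
  have := hS.pos x hx0
  have := hS.even x
  omega

/-- A family of pairwise orthogonal vectors of norm 2. -/
def IsRootFrame {ι : Type*} [DecidableEq ι] (S : Matrix (Fin 8) (Fin 8) ℤ)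
    (e : ι → Fin 8 → ℤ) : Prop :=
  ∀ i j, e i ⬝ᵥ S *ᵥ e j = if i = j then 2 else 0

/-- Half of the sum of the `e i` with `i ∈ I` is integral. -/
def HasHalfSum {ι : Type*} (e : ι → Fin 8 → ℤ) (I : Finset ι) : Prop :=
  ∃ f : Fin 8 → ℤ, (2 : ℤ) • f = ∑ i ∈ I, e i

theorem IsRootFrame.comp {ι κ : Type*} [DecidableEq ι] [DecidableEq κ]
    {S : Matrix (Fin 8) (Fin 8) ℤ} {e : κ → Fin 8 → ℤ} (he : IsRootFrame S e) (σ : ι ↪ κ) :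
    IsRootFrame S (e ∘ σ) := fun i j => by
  simp [he (σ i) (σ j)]

theorem hasHalfSum_comp {ι κ : Type*} {e : κ → Fin 8 → ℤ} (σ : ι ↪ κ) {I : Finset ι} :
    HasHalfSum (e ∘ σ) I ↔ HasHalfSum e (I.map σ) := by
  simp [HasHalfSum]

theorem IsRootFrame.sum_dotProduct_sum {ι : Type*} [DecidableEq ι]
    {S : Matrix (Fin 8) (Fin 8) ℤ} {e : ι → Fin 8 → ℤ} (he : IsRootFrame S e) (I J : Finset ι) :
    (∑ i ∈ I, e i) ⬝ᵥ S *ᵥ ∑ j ∈ J, e j = 2 * (I ∩ J).card := by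
  rw [sum_dotProduct, Finset.sum_congr rfl fun i _ => by
    rw [Matrix.mulVec_sum, dotProduct_sum, Finset.sum_congr rfl fun j _ => he i j,
      Finset.sum_ite_eq]]
  rw [Finset.sum_ite_mem, Finset.sum_const, nsmul_eq_mul, mul_comm]

theorem IsRootFrame.even_card_inter {ι : Type*} [DecidableEq ι]
    {S : Matrix (Fin 8) (Fin 8) ℤ} {e : ι → Fin 8 → ℤ} (he : IsRootFrame S e) {I J : Finset ι}
    (hI : HasHalfSum e I) (hJ : HasHalfSum e J) : Even (I ∩ J).card := by
  obtain ⟨f, hf⟩ := hI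
  obtain ⟨g, hg⟩ := hJ
  have := he.sum_dotProduct_sum I J
  rw [← hf, ← hg, mulVec_smul, dotProduct_smul, smul_dotProduct, smul_eq_mul, smul_eq_mul] at this
  rw [← Int.even_coe_nat]
  exact ⟨f ⬝ᵥ S *ᵥ g, by omega⟩

theorem IsRootFrame.four_dvd_card {ι : Type*} [DecidableEq ι]
    {S : Matrix (Fin 8) (Fin 8) ℤ} (hS : IsEvenUnimodularPos S)
    {e : ι → Fin 8 → ℤ} (he : IsRootFrame S e) {I : Finset ι}
    (hI : HasHalfSum e I) : 4 ∣ I.card := by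
  obtain ⟨f, hf⟩ := hI
  have := he.sum_dotProduct_sum I I
  rw [← hf, mulVec_smul, dotProduct_smul, smul_dotProduct, smul_eq_mul, smul_eq_mul,
    Finset.inter_self] at this
  have := hS.even f
  omega

theorem IsRootFrame.exists_nonempty_hasHalfSum {k : ℕ} (hk : 4 < k)
    {S : Matrix (Fin 8) (Fin 8) ℤ} (hS : S.det = 1) {e : Fin k → Fin 8 → ℤ}
    (he : IsRootFrame S e) : ∃ I : Finset (Fin k), I.Nonempty ∧ HasHalfSum e I := by
  let M : Matrix (Fin 8) (Fin k) (ZMod 2) := Matrix.of fun a i => (e i a : ZMod 2)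
  let T : Matrix (Fin 8) (Fin 8) (ZMod 2) := S.map Int.cast
  have hT : IsUnit T.det := by
    have : T.det = ((S.det : ℤ) : ZMod 2) := (Int.cast_det S).symm
    rw [this, hS]
    simp
  have hM : Mᵀ * T * M = 0 := by
    ext i j
    have := congrArg (Int.cast : ℤ → ZMod 2) (he i j)
    have h2 : ((if i = j then 2 else 0 : ℤ) : ZMod 2) = 0 := by split_ifs <;> rfl
    rw [h2] at this
    rw [Matrix.mul_assoc, Matrix.zero_apply, ← this]
    simp [Matrix.mul_apply, dotProduct, mulVec, M, T]
  have hr := Matrix.rank_add_rank_le_card_of_mul_eq_zero hM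
  rw [rank_mul_eq_left_of_isUnit_det _ _ hT, rank_transpose, Fintype.card_fin] at hr
  have hli : ¬ LinearIndependent (ZMod 2) M.col := fun h => by
    have := Matrix.rank_transpose M ▸ LinearIndependent.rank_matrix (M := Mᵀ) h
    rw [Fintype.card_fin] at this
    omega
  obtain ⟨g, hg, i, hi⟩ := Fintype.not_linearIndependent_iff.1 hli
  refine ⟨Finset.univ.filter fun i => g i ≠ 0, ⟨i, by simpa using hi⟩, ?_⟩
  have hdvd : ∀ a, (2 : ℤ) ∣ (∑ i with g i ≠ 0, e i) a := fun a => by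
    have hga : ∑ i, g i * M a i = 0 := by
      simpa [Finset.sum_apply] using congrFun hg a
    rw [← Nat.cast_two, ← ZMod.intCast_zmod_eq_zero_iff_dvd]
    refine Eq.trans ?_ hga
    simp only [Finset.sum_apply, Int.cast_sum, Finset.sum_filter]
    refine Finset.sum_congr rfl fun i _ => ?_
    have : ∀ x y : ZMod 2, (if x ≠ 0 then y else 0) = x * y := by decide
    rw [apply_ite (Int.cast : ℤ → ZMod 2), Int.cast_zero, this]
    rfl
  choose f hf using hdvd
  exact ⟨f, funext fun a => (hf a).symm⟩

/-- Among five pairwise orthogonal roots there are four whose half sum is integral. -/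
theorem IsRootFrame.exists_hasHalfSum_erase {k : ℕ} {S : Matrix (Fin 8) (Fin 8) ℤ}
    (hS : IsEvenUnimodularPos S) {e : Fin k → Fin 8 → ℤ} (he : IsRootFrame S e)
    (σ : Fin 5 ↪ Fin k) : ∃ j, HasHalfSum e ((Finset.univ.erase j).map σ) := by
  obtain ⟨I, hI, hI'⟩ := (he.comp σ).exists_nonempty_hasHalfSum (by norm_num) hS.det
  have h1 := (he.comp σ).four_dvd_card hS hI'
  have h2 := hI.card_pos
  have h3 := I.card_le_univ
  rw [Fintype.card_fin] at h3
  obtain ⟨j, hj⟩ : ∃ j, Iᶜ = {j} := Finset.card_eq_one.1 (by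
    rw [Finset.card_compl, Fintype.card_fin]; omega)
  refine ⟨j, ?_⟩
  rw [← hasHalfSum_comp, ← Finset.compl_singleton, ← hj, compl_compl]
  exact hI'

theorem transpose_of_mul_eq {k : ℕ} {e v : Fin k → Fin 8 → ℤ} {Q : Matrix (Fin k) (Fin k) ℤ}
    (hv : ∀ j, e j = ∑ i, Q i j • v i) : (Matrix.of v)ᵀ * Q = (Matrix.of e)ᵀ := by
  ext a i
  simp [hv i, Matrix.mul_apply, mul_comm]

theorem IsRootFrame.transpose_mul_mul_eq_two {k : ℕ} {S : Matrix (Fin 8) (Fin 8) ℤ}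
    {e : Fin k → Fin 8 → ℤ} (he : IsRootFrame S e) {v : Fin k → Fin 8 → ℤ}
    {Q : Matrix (Fin k) (Fin k) ℤ} (hv : ∀ j, e j = ∑ i, Q i j • v i) :
    ((Matrix.of v)ᵀ * Q)ᵀ * S * ((Matrix.of v)ᵀ * Q) = 2 := by
  rw [transpose_of_mul_eq hv]
  ext i j
  have h := he i j
  rw [Matrix.mul_assoc, Matrix.mul_apply, ofNat_apply]
  simpa [dotProduct, mulVec, Matrix.mul_apply] using h

open MeasureTheory in
theorem IsRootFrame.exists_extension {k m : ℕ} (hkm : k + m = 8) {S : Matrix (Fin 8) (Fin 8) ℤ}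
    (hS : IsEvenUnimodularPos S) {e : Fin k → Fin 8 → ℤ} (he : IsRootFrame S e)
    (v : Fin k → Fin 8 → ℤ) (Q : Matrix (Fin k) (Fin k) ℤ) (hv : ∀ j, e j = ∑ i, Q i j • v i)
    (c : ℝ) (hc : 0 < c) (hQ : 2 ^ k < c ^ 2 * (Q.det : ℝ) ^ 2)
    (hball : ENNReal.ofReal (2 ^ m * c) ≤
      volume (Metric.ball (0 : EuclideanSpace ℝ (Fin m)) 2)) :
    ∃ e' : Fin (k + 1) → Fin 8 → ℤ, IsRootFrame S e' ∧ e' ∘ Fin.castSuccEmb = e := by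
  obtain ⟨x, hx, hvx⟩ := exists_short_vec_orthogonal hkm hS (Matrix.of v)ᵀ Q
    (he.transpose_mul_mul_eq_two hv) c hc hQ hball
  have hex : ∀ j, e j ⬝ᵥ S *ᵥ x = 0 := fun j => by
    have h : ((Matrix.of v)ᵀ * Q)ᵀ *ᵥ (S *ᵥ x) = 0 := by
      rw [transpose_mul, ← mulVec_mulVec, mulVec_mulVec x, hvx, mulVec_zero]
    rw [transpose_of_mul_eq hv] at h
    exact congrFun h j
  have hxe : ∀ j, x ⬝ᵥ S *ᵥ e j = 0 := fun j => by
    rw [← hex j, dotProduct_mulVec, ← mulVec_transpose, hS.symm.eq, dotProduct_comm]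
  refine ⟨Fin.snoc e x, fun i j => ?_, by ext; simp⟩
  refine Fin.lastCases ?_ (fun i => ?_) i <;> refine Fin.lastCases ?_ (fun j => ?_) j
  · simpa using hx
  · simpa [(Fin.castSucc_lt_last j).ne'] using hxe j
  · simpa using hex i
  · simpa using he i j

open MeasureTheory in
theorem ofReal_mul_le_volume_ball_two_of_even {j : ℕ} {c : ℝ} (hj : j ≠ 0)
    (h : c * j.factorial ≤ 3.14 ^ j) : ENNReal.ofReal (2 ^ (2 * j) * c) ≤
      volume (Metric.ball (0 : EuclideanSpace ℝ (Fin (2 * j))) 2) := by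
  have : Nonempty (Fin (2 * j)) := ⟨⟨0, by omega⟩⟩
  rw [InnerProductSpace.volume_ball_of_dim_even (k := j) (by simp),
    ← ENNReal.ofReal_pow zero_le_two, ← ENNReal.ofReal_mul (by positivity), finrank_euclideanSpace,
    Fintype.card_fin]
  refine ENNReal.ofReal_le_ofReal (mul_le_mul_of_nonneg_left ?_ (by positivity))
  rw [le_div_iff₀ (by positivity)]
  exact h.trans (by gcongr; exact Real.pi_gt_d2.le)

open MeasureTheory in
theorem ofReal_mul_le_volume_ball_two_of_odd {j : ℕ} {c : ℝ}
    (h : c * (2 * j + 1).doubleFactorial ≤ 2 ^ (j + 1) * 3.14 ^ j) :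
    ENNReal.ofReal (2 ^ (2 * j + 1) * c) ≤
      volume (Metric.ball (0 : EuclideanSpace ℝ (Fin (2 * j + 1))) 2) := by
  rw [InnerProductSpace.volume_ball_of_dim_odd (k := j) (by simp),
    ← ENNReal.ofReal_pow zero_le_two, ← ENNReal.ofReal_mul (by positivity), finrank_euclideanSpace,
    Fintype.card_fin]
  refine ENNReal.ofReal_le_ofReal (mul_le_mul_of_nonneg_left ?_ (by positivity))
  rw [le_div_iff₀ (by simp [Nat.doubleFactorial_pos])]
  exact h.trans (by rw [mul_comm (2 ^ (j + 1) : ℝ)]; gcongr; exact Real.pi_gt_d2.le)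


/-- The root frame `e` and the basis `v` of the lattice are related by `e j = ∑ i, Q i j • v i`. -/
def frameCoeff : Matrix (Fin 8) (Fin 8) ℤ :=
  !![1, 0, 0, -1, 0, 1, -1, 0;
     0, 1, 0, -1, 0, 1, 0, -1;
     0, 0, 1, -1, 0, 0, -1, -1;
     0, 0, 0, 2, 0, -2, 0, 0;
     0, 0, 0, 0, 1, -1, -1, -1;
     0, 0, 0, 0, 0, 2, 0, 0;
     0, 0, 0, 0, 0, 0, 2, 0;
     0, 0, 0, 0, 0, 0, 0, 2]

theorem det_frameCoeff_submatrix {k : ℕ} (hk : k ≤ 8) :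
    (frameCoeff.submatrix (Fin.castLE hk) (Fin.castLE hk)).det =
      ∏ i : Fin k, frameCoeff (Fin.castLE hk i) (Fin.castLE hk i) := by
  refine det_of_isUpperTriangular fun i j hij => ?_
  have h : ∀ p : Fin 8 × Fin 8, p.2 < p.1 → frameCoeff p.1 p.2 = 0 := by decide
  exact h (Fin.castLE hk i, Fin.castLE hk j) hij

open MeasureTheory in
theorem exists_isRootFrame_five {S : Matrix (Fin 8) (Fin 8) ℤ} (hS : IsEvenUnimodularPos S) :
    ∃ e : Fin 5 → Fin 8 → ℤ, IsRootFrame S e := by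
  have step : ∀ {k m : ℕ} (hkm : k + m = 8) (e : Fin k → Fin 8 → ℤ) (he : IsRootFrame S e)
      (c : ℝ) (hc : 0 < c) (hQ : 2 ^ k < c ^ 2) (hball : ENNReal.ofReal (2 ^ m * c) ≤
        volume (Metric.ball (0 : EuclideanSpace ℝ (Fin m)) 2)),
      ∃ e' : Fin (k + 1) → Fin 8 → ℤ, IsRootFrame S e' := fun hkm e he c hc hQ hball => by
    obtain ⟨e', he', -⟩ := he.exists_extension hkm hS e 1
      (fun j => by simp [Matrix.one_apply]) c hc (by simpa using hQ) hball
    exact ⟨e', he'⟩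
  obtain ⟨e₁, he₁⟩ := step (k := 0) (m := 8) rfl Fin.elim0 (fun i => i.elim0) 3
    (by norm_num) (by norm_num)
    (ofReal_mul_le_volume_ball_two_of_even (j := 4) (by norm_num) (by norm_num [Nat.factorial]))
  obtain ⟨e₂, he₂⟩ := step (m := 7) rfl e₁ he₁ 3 (by norm_num) (by norm_num)
    (ofReal_mul_le_volume_ball_two_of_odd (j := 3) (by norm_num [Nat.doubleFactorial]))
  obtain ⟨e₃, he₃⟩ := step (m := 6) rfl e₂ he₂ 3 (by norm_num) (by norm_num)
    (ofReal_mul_le_volume_ball_two_of_even (j := 3) (by norm_num) (by norm_num [Nat.factorial]))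
  obtain ⟨e₄, he₄⟩ := step (m := 5) rfl e₃ he₃ 3 (by norm_num) (by norm_num)
    (ofReal_mul_le_volume_ball_two_of_odd (j := 2) (by norm_num [Nat.doubleFactorial]))
  exact step (m := 4) rfl e₄ he₄ (9 / 2) (by norm_num) (by norm_num)
    (ofReal_mul_le_volume_ball_two_of_even (j := 2) (by norm_num) (by norm_num [Nat.factorial]))

theorem exists_isRootFrame_five_hasHalfSum {S : Matrix (Fin 8) (Fin 8) ℤ}
    (hS : IsEvenUnimodularPos S) :
    ∃ e : Fin 5 → Fin 8 → ℤ, IsRootFrame S e ∧ HasHalfSum e {0, 1, 2, 3} := by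
  obtain ⟨e, he⟩ := exists_isRootFrame_five hS
  obtain ⟨j, hj⟩ := he.exists_hasHalfSum_erase hS (Function.Embedding.refl _)
  refine ⟨e ∘ (Equiv.swap j 4).toEmbedding, he.comp _, ?_⟩
  rw [hasHalfSum_comp]
  have key : ∀ j : Fin 5, ({0, 1, 2, 3} : Finset (Fin 5)).map (Equiv.swap j 4).toEmbedding =
    (Finset.univ.erase j).map (Function.Embedding.refl _) := by decide
  rwa [key]

theorem exists_isRootFrame_six_hasHalfSum {S : Matrix (Fin 8) (Fin 8) ℤ}
    (hS : IsEvenUnimodularPos S) :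
    ∃ e : Fin 6 → Fin 8 → ℤ, IsRootFrame S e ∧ HasHalfSum e {0, 1, 2, 3} ∧
      HasHalfSum e {2, 3, 4, 5} := by
  obtain ⟨e₀, he₀, f, hf⟩ := exists_isRootFrame_five_hasHalfSum hS
  obtain ⟨e, he, rfl⟩ := he₀.exists_extension (m := 3) rfl hS ![e₀ 0, e₀ 1, e₀ 2, f, e₀ 4]
    (frameCoeff.submatrix (Fin.castLE (by norm_num)) (Fin.castLE (by norm_num))) (fun j => by
      ext a
      have := congrFun hf a
      fin_cases j <;> simp [frameCoeff, Fin.sum_univ_succ] at this ⊢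
      omega) 3 (by norm_num)
    (by rw [det_frameCoeff_submatrix]; norm_num [frameCoeff, Fin.prod_univ_succ])
    (ofReal_mul_le_volume_ball_two_of_odd (j := 1) (by norm_num [Nat.doubleFactorial]))
  have h₁ : HasHalfSum e {0, 1, 2, 3} := (hasHalfSum_comp Fin.castSuccEmb).1 ⟨f, hf⟩
  let σ : Fin 5 ↪ Fin 6 := ⟨![1, 2, 3, 4, 5], by decide⟩
  obtain ⟨j, hj⟩ := he.exists_hasHalfSum_erase hS σ
  have key : ∀ j, Even (({0, 1, 2, 3} : Finset (Fin 6)) ∩ (Finset.univ.erase j).map σ).card →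
      ∃ τ ∈ [Equiv.refl _, Equiv.swap 1 2, Equiv.swap 1 3],
        ({0, 1, 2, 3} : Finset (Fin 6)).map τ.toEmbedding = {0, 1, 2, 3} ∧
        ({2, 3, 4, 5} : Finset (Fin 6)).map τ.toEmbedding = (Finset.univ.erase j).map σ := by
    decide
  obtain ⟨τ, -, hτ₁, hτ₂⟩ := key j (he.even_card_inter h₁ hj)
  refine ⟨e ∘ τ.toEmbedding, he.comp _, ?_⟩
  rw [hasHalfSum_comp, hasHalfSum_comp, hτ₁, hτ₂]
  exact ⟨h₁, hj⟩

theorem exists_isRootFrame_seven_hasHalfSum {S : Matrix (Fin 8) (Fin 8) ℤ}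
    (hS : IsEvenUnimodularPos S) :
    ∃ e : Fin 7 → Fin 8 → ℤ, IsRootFrame S e ∧ HasHalfSum e {0, 1, 2, 3} ∧
      HasHalfSum e {2, 3, 4, 5} ∧ HasHalfSum e {0, 2, 4, 6} := by
  obtain ⟨e₀, he₀, ⟨f₁, hf₁⟩, f₂, hf₂⟩ := exists_isRootFrame_six_hasHalfSum hS
  obtain ⟨e, he, rfl⟩ := he₀.exists_extension (m := 2) rfl hS
    ![e₀ 0, e₀ 1, e₀ 2, f₁, e₀ 4, f₂]
    (frameCoeff.submatrix (Fin.castLE (by norm_num)) (Fin.castLE (by norm_num))) (fun j => by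
      ext a
      have h₁ := congrFun hf₁ a
      have h₂ := congrFun hf₂ a
      fin_cases j <;> simp [frameCoeff, Fin.sum_univ_succ] at h₁ h₂ ⊢ <;> omega) 3 (by norm_num)
    (by rw [det_frameCoeff_submatrix]; norm_num [frameCoeff, Fin.prod_univ_succ])
    (ofReal_mul_le_volume_ball_two_of_even (j := 1) (by norm_num) (by norm_num [Nat.factorial]))
  have h₁ : HasHalfSum e {0, 1, 2, 3} := (hasHalfSum_comp Fin.castSuccEmb).1 ⟨f₁, hf₁⟩
  have h₂ : HasHalfSum e {2, 3, 4, 5} := (hasHalfSum_comp Fin.castSuccEmb).1 ⟨f₂, hf₂⟩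
  let σ : Fin 5 ↪ Fin 7 := ⟨![0, 1, 2, 4, 6], by decide⟩
  obtain ⟨j, hj⟩ := he.exists_hasHalfSum_erase hS σ
  have key : ∀ j, Even (({0, 1, 2, 3} : Finset (Fin 7)) ∩ (Finset.univ.erase j).map σ).card →
      Even (({2, 3, 4, 5} : Finset (Fin 7)) ∩ (Finset.univ.erase j).map σ).card →
      ∃ τ ∈ [Equiv.refl _, Equiv.swap 0 1],
        ({0, 1, 2, 3} : Finset (Fin 7)).map τ.toEmbedding = {0, 1, 2, 3} ∧
        ({2, 3, 4, 5} : Finset (Fin 7)).map τ.toEmbedding = {2, 3, 4, 5} ∧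
        ({0, 2, 4, 6} : Finset (Fin 7)).map τ.toEmbedding = (Finset.univ.erase j).map σ := by
    decide
  obtain ⟨τ, -, hτ₁, hτ₂, hτ₃⟩ :=
    key j (he.even_card_inter h₁ hj) (he.even_card_inter h₂ hj)
  refine ⟨e ∘ τ.toEmbedding, he.comp _, ?_⟩
  rw [hasHalfSum_comp, hasHalfSum_comp, hasHalfSum_comp, hτ₁, hτ₂, hτ₃]
  exact ⟨h₁, h₂, hj⟩

theorem exists_isRootFrame_eight_hasHalfSum {S : Matrix (Fin 8) (Fin 8) ℤ}
    (hS : IsEvenUnimodularPos S) :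
    ∃ e : Fin 8 → Fin 8 → ℤ, IsRootFrame S e ∧ HasHalfSum e {0, 1, 2, 3} ∧
      HasHalfSum e {2, 3, 4, 5} ∧ HasHalfSum e {0, 2, 4, 6} ∧ HasHalfSum e {1, 2, 4, 7} := by
  obtain ⟨e₀, he₀, ⟨f₁, hf₁⟩, ⟨f₂, hf₂⟩, f₃, hf₃⟩ := exists_isRootFrame_seven_hasHalfSum hS
  obtain ⟨e, he, rfl⟩ := he₀.exists_extension (m := 1) rfl hS
    ![e₀ 0, e₀ 1, e₀ 2, f₁, e₀ 4, f₂, f₃]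
    (frameCoeff.submatrix (Fin.castLE (by norm_num)) (Fin.castLE (by norm_num))) (fun j => by
      ext a
      have h₁ := congrFun hf₁ a
      have h₂ := congrFun hf₂ a
      have h₃ := congrFun hf₃ a
      fin_cases j <;> simp [frameCoeff, Fin.sum_univ_succ] at h₁ h₂ h₃ ⊢ <;> omega)
    (3 / 2) (by norm_num)
    (by rw [det_frameCoeff_submatrix]; norm_num [frameCoeff, Fin.prod_univ_succ])
    (ofReal_mul_le_volume_ball_two_of_odd (j := 0) (by norm_num [Nat.doubleFactorial]))
  have h₁ : HasHalfSum e {0, 1, 2, 3} := (hasHalfSum_comp Fin.castSuccEmb).1 ⟨f₁, hf₁⟩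
  have h₂ : HasHalfSum e {2, 3, 4, 5} := (hasHalfSum_comp Fin.castSuccEmb).1 ⟨f₂, hf₂⟩
  have h₃ : HasHalfSum e {0, 2, 4, 6} := (hasHalfSum_comp Fin.castSuccEmb).1 ⟨f₃, hf₃⟩
  let σ : Fin 5 ↪ Fin 8 := ⟨![0, 1, 2, 4, 7], by decide⟩
  obtain ⟨j, hj⟩ := he.exists_hasHalfSum_erase hS σ
  have key : ∀ j, Even (({0, 1, 2, 3} : Finset (Fin 8)) ∩ (Finset.univ.erase j).map σ).card →
      Even (({2, 3, 4, 5} : Finset (Fin 8)) ∩ (Finset.univ.erase j).map σ).card →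
      Even (({0, 2, 4, 6} : Finset (Fin 8)) ∩ (Finset.univ.erase j).map σ).card →
      (Finset.univ.erase j).map σ = {1, 2, 4, 7} := by
    decide
  rw [key j (he.even_card_inter h₁ hj) (he.even_card_inter h₂ hj) (he.even_card_inter h₃ hj)] at hj
  exact ⟨e, he, h₁, h₂, h₃, hj⟩

theorem IsEvenUnimodularPos.exists_mul_frameCoeff {S : Matrix (Fin 8) (Fin 8) ℤ}
    (hS : IsEvenUnimodularPos S) :
    ∃ V : Matrix (Fin 8) (Fin 8) ℤ, (V * frameCoeff)ᵀ * S * (V * frameCoeff) = 2 := by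
  obtain ⟨e, he, ⟨f₁, hf₁⟩, ⟨f₂, hf₂⟩, ⟨f₃, hf₃⟩, f₄, hf₄⟩ :=
    exists_isRootFrame_eight_hasHalfSum hS
  refine ⟨(Matrix.of ![e 0, e 1, e 2, f₁, e 4, f₂, f₃, f₄])ᵀ, he.transpose_mul_mul_eq_two ?_⟩
  intro j
  ext a
  have h₁ := congrFun hf₁ a
  have h₂ := congrFun hf₂ a
  have h₃ := congrFun hf₃ a
  have h₄ := congrFun hf₄ a
  fin_cases j <;> simp [frameCoeff, Fin.sum_univ_succ] at h₁ h₂ h₃ h₄ ⊢ <;> omega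

theorem det_frameCoeff : frameCoeff.det = 16 := by
  have := det_frameCoeff_submatrix le_rfl
  rw [show frameCoeff.submatrix (Fin.castLE le_rfl) (Fin.castLE le_rfl) = frameCoeff from rfl]
    at this
  rw [this]
  norm_num [frameCoeff, Fin.prod_univ_succ]

theorem isUnit_det_of_mul_frameCoeff {S V : Matrix (Fin 8) (Fin 8) ℤ} (hS : S.det = 1)
    (hV : (V * frameCoeff)ᵀ * S * (V * frameCoeff) = 2) : IsUnit V.det := by
  have h := congrArg det hV
  have h2 : (2 : Matrix (Fin 8) (Fin 8) ℤ) = (2 : ℤ) • 1 := by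
    ext i j
    simp [ofNat_apply, one_apply]
  rw [h2, det_smul, det_mul, det_mul, det_transpose, det_mul, hS, det_frameCoeff] at h
  have : V.det * V.det = 1 := by
    simp at h
    linarith
  exact IsUnit.of_mul_eq_one _ this

theorem transpose_mul_mul_eq_of_mul_frameCoeff {S₁ S₂ V₁ V₂ : Matrix (Fin 8) (Fin 8) ℤ}
    (h₁ : (V₁ * frameCoeff)ᵀ * S₁ * (V₁ * frameCoeff) = 2)
    (h₂ : (V₂ * frameCoeff)ᵀ * S₂ * (V₂ * frameCoeff) = 2) :
    V₁ᵀ * S₁ * V₁ = V₂ᵀ * S₂ * V₂ := by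
  have hQ : IsRegular frameCoeff := isRegular_of_isLeftRegular_det
    (IsRegular.of_ne_zero (by norm_num [det_frameCoeff])).left
  have hQt : IsRegular frameCoeffᵀ := isRegular_of_isLeftRegular_det
    (IsRegular.of_ne_zero (by norm_num [det_frameCoeff])).left
  apply hQ.right
  apply hQt.left
  simpa only [transpose_mul, Matrix.mul_assoc] using h₁.trans h₂.symm

/-- Up to integral equivalence there is only one even, positive definite, integer
quadratic form of determinant 1 and rank 8: if `S₁`, `S₂` are symmetric `8 × 8` integer
matrices which are positive definite (`ᵗx·S·x > 0` for all `x ≠ 0`), have determinant 1,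
and are even (`ᵗx·S·x ≡ 0 (mod 2)` for all `x ∈ ℤ^8`), then there is `U ∈ GL(8,ℤ)`
with `ᵗU·S₁·U = S₂`. -/
theorem even_unimodular_rank_eight_unique
    (S₁ S₂ : Matrix (Fin 8) (Fin 8) ℤ)
    (h₁symm : S₁.IsSymm) (h₂symm : S₂.IsSymm)
    (h₁pos : ∀ x : Fin 8 → ℤ, x ≠ 0 → 0 < x ⬝ᵥ S₁.mulVec x)
    (h₂pos : ∀ x : Fin 8 → ℤ, x ≠ 0 → 0 < x ⬝ᵥ S₂.mulVec x)
    (h₁det : S₁.det = 1) (h₂det : S₂.det = 1)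
    (h₁even : ∀ x : Fin 8 → ℤ, 2 ∣ x ⬝ᵥ S₁.mulVec x)
    (h₂even : ∀ x : Fin 8 → ℤ, 2 ∣ x ⬝ᵥ S₂.mulVec x) :
    ∃ U : Matrix (Fin 8) (Fin 8) ℤ, IsUnit U.det ∧ Uᵀ * S₁ * U = S₂ := by
  obtain ⟨V₁, hV₁⟩ := IsEvenUnimodularPos.exists_mul_frameCoeff ⟨h₁symm, h₁pos, h₁det, h₁even⟩
  obtain ⟨V₂, hV₂⟩ := IsEvenUnimodularPos.exists_mul_frameCoeff ⟨h₂symm, h₂pos, h₂det, h₂even⟩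
  have hu₁ := isUnit_det_of_mul_frameCoeff h₁det hV₁
  have hu₂ := isUnit_det_of_mul_frameCoeff h₂det hV₂
  refine ⟨V₁ * V₂⁻¹, ?_, ?_⟩
  · rw [det_mul]
    exact hu₁.mul (isUnit_nonsing_inv_det V₂ hu₂)
  · have h := transpose_mul_mul_eq_of_mul_frameCoeff hV₁ hV₂
    calc (V₁ * V₂⁻¹)ᵀ * S₁ * (V₁ * V₂⁻¹) = (V₂⁻¹)ᵀ * (V₁ᵀ * S₁ * V₁) * V₂⁻¹ := by
          simp only [transpose_mul, Matrix.mul_assoc]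
      _ = (V₂ * V₂⁻¹)ᵀ * S₂ * (V₂ * V₂⁻¹) := by
          rw [h]
          simp only [transpose_mul, Matrix.mul_assoc]
      _ = S₂ := by
          rw [mul_nonsing_inv V₂ hu₂, transpose_one, Matrix.one_mul, Matrix.mul_one]
end
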